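/- arXiv:1007.1983 — 2 statements merged into one kernel-verified Lean document; each statement's English description precedes it below -/
import Mathlib

section
/- Let M = [[A, C], [0, B]] be a block upper triangular n×n matrix over K with A of size p×p, B of size (n−p)×(n−p), C of size p×(n−p). If M is diagonalizable over K, then for every eigenvalue λ of B and every eigenvector X of B for λ, one has CX ∈ im(A − λ·I_p). -/
open Matrix
def IsDiagonalizable {K : Type*} [Field K] {m : Type*} [Fintype m] [DecidableEq m]
    (A : Matrix m m K) : Prop :=
  ∃ P : Matrix m m K, IsUnit P ∧ (P⁻¹ * A * P).IsDiag
def FormallyReal (K : Type*) [Field K] : Prop := ¬ IsSumSq (-1 : K)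
def Pythagorean (K : Type*) [Field K] : Prop := ∀ a b : K, ∃ c : K, a ^ 2 + b ^ 2 = c ^ 2

theorem sq_ker_aux {K : Type*} [Field K] {m : Type*} [Fintype m] [DecidableEq m]
    (M : Matrix m m K) (hM : IsDiagonalizable M) (lam : K) (v : m → K)
    (h : (M - lam • 1).mulVec ((M - lam • 1).mulVec v) = 0) : (M - lam • 1).mulVec v = 0 := by
  obtain ⟨P, hP, hD⟩ := hM
  have hdet : IsUnit P.det := (Matrix.isUnit_iff_isUnit_det P).1 hP
  have h1 : P * P⁻¹ = 1 := Matrix.mul_nonsing_inv P hdet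
  have h2 : P⁻¹ * P = 1 := Matrix.nonsing_inv_mul P hdet
  obtain ⟨d, hd⟩ : ∃ d : m → K, P⁻¹ * M * P = Matrix.diagonal d :=
    ⟨_, (hD.diagonal_diag).symm⟩
  have hN : P⁻¹ * (M - lam • 1) = Matrix.diagonal (fun i => d i - lam) * P⁻¹ := by
    have : Matrix.diagonal (fun i => d i - lam) = Matrix.diagonal d - lam • (1 : Matrix m m K) := by
      ext i j
      by_cases hij : i = j
      · subst hij; simp
      · simp [hij]
    rw [this, ← hd, Matrix.sub_mul, Matrix.mul_assoc _ P, h1, Matrix.mul_sub]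
    simp
  have hv : ∀ w, P⁻¹.mulVec ((M - lam • 1).mulVec w)
      = (Matrix.diagonal (fun i => d i - lam)).mulVec (P⁻¹.mulVec w) := by
    intro w
    rw [Matrix.mulVec_mulVec, hN, Matrix.mulVec_mulVec]
  have h3 := congrArg P⁻¹.mulVec h
  rw [hv, hv] at h3
  have h4 : P⁻¹.mulVec ((M - lam • 1).mulVec v) = 0 := by
    rw [hv]
    ext i
    have := congrFun h3 i
    simp only [Matrix.mulVec_diagonal, Matrix.mulVec_zero, Pi.zero_apply] at this ⊢
    rcases mul_eq_zero.1 this with h | h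
    · rw [h, zero_mul]
    · exact h
  have h5 := congrArg P.mulVec h4
  rwa [Matrix.mulVec_mulVec, h1, Matrix.one_mulVec, Matrix.mulVec_zero] at h5

theorem stmt8 {K : Type*} [Field K] {p q : ℕ}
    (A : Matrix (Fin p) (Fin p) K) (B : Matrix (Fin q) (Fin q) K)
    (C : Matrix (Fin p) (Fin q) K)
    (hM : IsDiagonalizable (Matrix.fromBlocks A C 0 B))
    (lam : K) (X : Fin q → K) (hX : X ≠ 0) (hBX : B.mulVec X = lam • X) :
    ∃ Y : Fin p → K, (A - lam • 1).mulVec Y = C.mulVec X := by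
  have key := sq_ker_aux _ hM lam
  have hN : ∀ (u : Fin p → K) (x : Fin q → K),
      (Matrix.fromBlocks A C 0 B - lam • 1).mulVec (Sum.elim u x)
        = Sum.elim ((A - lam • 1).mulVec u + C.mulVec x) (B.mulVec x - lam • x) := by
    intro u x
    rw [Matrix.sub_mulVec, Matrix.fromBlocks_mulVec]
    ext i
    rcases i with i | i <;>
      simp [Matrix.sub_mulVec, Matrix.smul_mulVec] <;> ring
  have z0 : (Sum.elim (0 : Fin p → K) (0 : Fin q → K)) = 0 := by
    ext i; rcases i with i | i <;> rfl
  have hA : ∀ u, (A - lam • 1).mulVec ((A - lam • 1).mulVec u) = 0 →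
      (A - lam • 1).mulVec u = 0 := by
    intro u hu
    have := key (Sum.elim u 0) (by simp [hN, hu])
    ext i
    simpa [hN] using congrFun this (Sum.inl i)
  let f : (Fin p → K) →ₗ[K] (Fin p → K) := (A - lam • 1).mulVecLin
  have hdis : Disjoint (LinearMap.ker f) (LinearMap.range f) := by
    rw [Submodule.disjoint_def]
    rintro _ hx ⟨u, rfl⟩
    exact hA u hx
  have htop : LinearMap.ker f ⊔ LinearMap.range f = ⊤ := by
    apply Submodule.eq_top_of_disjoint _ _ _ hdis
    rw [add_comm]
    exact (LinearMap.finrank_range_add_finrank_ker f).ge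
  have hmem : C.mulVec X ∈ LinearMap.ker f ⊔ LinearMap.range f := htop ▸ Submodule.mem_top
  obtain ⟨k, hk, _, ⟨u, rfl⟩, hku⟩ := Submodule.mem_sup.1 hmem
  have hk' : (A - lam • 1).mulVec k = 0 := hk
  have hku' : k + (A - lam • 1).mulVec u = C.mulVec X := hku
  have e : (Matrix.fromBlocks A C 0 B - lam • 1).mulVec (Sum.elim (-u) X) = Sum.elim k 0 := by
    rw [hN, ← hku', hBX, Matrix.mulVec_neg]
    simp
  have := key (Sum.elim (-u) X) (by rw [e, hN, hk']; simp)
  rw [e] at this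
  have k0 : k = 0 := by
    ext i
    simpa using congrFun this (Sum.inl i)
  exact ⟨u, by rw [← hku', k0, zero_add]⟩
end

section
/- Assume Mat_n(K) contains a diagonalizable linear subspace of dimension n(n+1)/2, with n ≥ 2. Then every such subspace V is conjugate to S_n(K): there exists P ∈ GL_n(K) with V = P·S_n(K)·P^{-1}; moreover K is formally real and Pythagorean, and every symmetric matrix in Mat_n(K) is diagonalizable. -/
open Matrix
section helpers
variable {K : Type*} [Field K] {m : Type*} [Fintype m] [DecidableEq m]

lemma diagz_iff (A : Matrix m m K) : IsDiagonalizable A ↔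
    ∃ (P Q : Matrix m m K) (d : m → K), Q * P = 1 ∧ P * Q = 1 ∧ A = P * diagonal d * Q := by
  constructor
  · rintro ⟨P, hP, h⟩
    have hd : IsUnit P.det := (Matrix.isUnit_iff_isUnit_det P).1 hP
    refine ⟨P, P⁻¹, (P⁻¹ * A * P).diag, Matrix.nonsing_inv_mul P hd,
      Matrix.mul_nonsing_inv P hd, ?_⟩
    rw [h.diagonal_diag]
    simp only [Matrix.mul_assoc, Matrix.mul_nonsing_inv P hd, Matrix.mul_one]
    rw [← Matrix.mul_assoc, Matrix.mul_nonsing_inv P hd, Matrix.one_mul]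
  · rintro ⟨P, Q, d, h1, h2, rfl⟩
    refine ⟨P, ⟨⟨P, Q, h2, h1⟩, rfl⟩, ?_⟩
    have : P⁻¹ = Q := Matrix.inv_eq_left_inv h1
    rw [this]
    have : Q * (P * diagonal d * Q) * P = diagonal d := by
      rw [← Matrix.mul_assoc, ← Matrix.mul_assoc, h1, Matrix.one_mul, Matrix.mul_assoc, h1,
        Matrix.mul_one]
    rw [this]
    exact isDiag_diagonal d

lemma diagz_conj {A P Q : Matrix m m K} (h1 : Q * P = 1) (h2 : P * Q = 1)
    (hA : IsDiagonalizable A) : IsDiagonalizable (P * A * Q) := by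
  rw [diagz_iff] at hA ⊢
  obtain ⟨R, S, d, h3, h4, rfl⟩ := hA
  refine ⟨P * R, S * Q, d, ?_, ?_, ?_⟩
  · rw [Matrix.mul_assoc, ← Matrix.mul_assoc Q, h1, Matrix.one_mul, h3]
  · rw [Matrix.mul_assoc, ← Matrix.mul_assoc R, h4, Matrix.one_mul, h2]
  · simp only [Matrix.mul_assoc]

lemma diagz_quad {A : Matrix m m K} (hA : IsDiagonalizable A) : IsDiagonalizable (A * A - A) := by
  rw [diagz_iff] at hA ⊢
  obtain ⟨P, Q, d, h1, h2, rfl⟩ := hA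
  refine ⟨P, Q, fun i => d i * d i - d i, h1, h2, ?_⟩
  have : diagonal (fun i => d i * d i - d i) = diagonal d * diagonal d - diagonal d := by
    rw [diagonal_mul_diagonal, diagonal_sub]
  rw [this, Matrix.mul_sub, Matrix.sub_mul]
  congr 1
  simp only [Matrix.mul_assoc]
  rw [← Matrix.mul_assoc Q P, h1, Matrix.one_mul]

lemma diagz_eig {A : Matrix m m K} (hA : IsDiagonalizable A) (h0 : A ≠ 0) :
    ∃ (c : K) (v : m → K), c ≠ 0 ∧ v ≠ 0 ∧ A *ᵥ v = c • v := by
  rw [diagz_iff] at hA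
  obtain ⟨P, Q, d, h1, h2, rfl⟩ := hA
  have : ∃ i, d i ≠ 0 := by
    by_contra! h
    apply h0
    have : d = 0 := funext h
    subst this
    simp
  obtain ⟨i, hi⟩ := this
  have key : Q *ᵥ (P *ᵥ (Pi.single i 1)) = Pi.single i 1 := by
    rw [mulVec_mulVec, h1, one_mulVec]
  refine ⟨d i, P *ᵥ (Pi.single i 1), hi, ?_, ?_⟩
  · intro h
    rw [h, mulVec_zero] at key
    have := congrFun key i
    simp at this
  · rw [← mulVec_mulVec, key, ← mulVec_mulVec, diagonal_mulVec_single, ← mulVec_smul]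
    congr 1
    ext j
    by_cases hj : j = i
    · subst hj; simp
    · simp [hj]

lemma diagz_nil {A : Matrix m m K} (hA : IsDiagonalizable A) (k : ℕ) (h : A ^ k = 0) : A = 0 := by
  by_contra h0
  obtain ⟨c, v, hc, hv, hcv⟩ := diagz_eig hA h0
  have : ∀ k : ℕ, A ^ k *ᵥ v = c ^ k • v := by
    intro k
    induction k with
    | zero => simp
    | succ k ih => rw [pow_succ, ← mulVec_mulVec, hcv, mulVec_smul, ih, smul_smul, pow_succ, mul_comm]
  have := this k
  rw [h, zero_mulVec] at this
  exact (smul_ne_zero (pow_ne_zero k hc) hv) this.symm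

end helpers

lemma strict_nil {K : Type*} [Field K] {n : ℕ} (A : Matrix (Fin n) (Fin n) K)
    (h : ∀ i j, j ≤ i → A i j = 0) : A ^ n = 0 := by
  have ht : A.BlockTriangular id := fun i j hij => h i j (le_of_lt hij)
  have hc := charpoly_of_isUpperTriangular A ht
  have := aeval_self_charpoly A
  rw [hc] at this
  simpa [h] using this

lemma card_low (n : ℕ) : Fintype.card {p : Fin n × Fin n // p.2 ≤ p.1} = n * (n + 1) / 2 := by
  rw [Fintype.card_subtype]
  have : (Finset.univ.filter (fun p : Fin n × Fin n => p.2 ≤ p.1)).card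
      = ∑ i : Fin n, ((i : ℕ) + 1) := by
    rw [← Finset.univ_product_univ, Finset.card_filter, Finset.sum_product]
    refine Finset.sum_congr rfl fun i _ => ?_
    rw [← Finset.card_filter]
    have : (Finset.univ.filter (fun j : Fin n => j ≤ i)) = Finset.Iic i := by ext; simp
    simp only [this, Fin.card_Iic]
  rw [this, Fin.sum_univ_eq_sum_range (fun i => i + 1), Finset.sum_add_distrib]
  have := Finset.sum_range_id_mul_two n
  simp
  rcases n with _ | n
  · simp
  · simp at this
    have h2 : (n+1) * (n+1+1) = (n+1) * n + 2 * (n+1) := by ring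
    rw [h2]
    omega

/-- the hypotheses of the theorem -/
structure Good {K : Type*} [Field K] {n : ℕ} (V : Submodule K (Matrix (Fin n) (Fin n) K)) :
    Prop where
  diagz : ∀ A ∈ V, IsDiagonalizable A
  dim : Module.finrank K V = n * (n + 1) / 2

section main
variable {K : Type*} [Field K] {n : ℕ} {V : Submodule K (Matrix (Fin n) (Fin n) K)}

lemma Good.inj (hV : Good V) {A B : Matrix (Fin n) (Fin n) K} (hA : A ∈ V) (hB : B ∈ V)
    (h : ∀ i j, j ≤ i → A i j = B i j) : A = B := by
  rw [← sub_eq_zero]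
  refine diagz_nil (hV.diagz _ (V.sub_mem hA hB)) n (strict_nil _ ?_)
  intro i j hij
  simp [h i j hij]

/-- restriction to the lower triangle -/
def lowMap (K : Type*) [Field K] (n : ℕ) :
    Matrix (Fin n) (Fin n) K →ₗ[K] ({p : Fin n × Fin n // p.2 ≤ p.1} → K) where
  toFun A p := A p.1.1 p.1.2
  map_add' _ _ := rfl
  map_smul' _ _ := rfl

lemma Good.surj (hV : Good V) (B : Matrix (Fin n) (Fin n) K) :
    ∃ A ∈ V, ∀ i j, j ≤ i → A i j = B i j := by
  have hinj : Function.Injective ((lowMap K n).comp V.subtype) := by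
    intro A A' h
    apply Subtype.ext
    refine hV.inj A.2 A'.2 fun i j hij => ?_
    exact congrFun h ⟨(i, j), hij⟩
  have hs := (LinearMap.injective_iff_surjective_of_finrank_eq_finrank
    (by rw [hV.dim, Module.finrank_fintype_fun_eq_card, card_low])).1 hinj
  obtain ⟨A, hA⟩ := hs (lowMap K n B)
  exact ⟨A, A.2, fun i j hij => congrFun hA ⟨(i, j), hij⟩⟩

/-- conjugation -/
def conjEquiv (P Q : Matrix (Fin n) (Fin n) K) (h1 : Q * P = 1) (h2 : P * Q = 1) :
    Matrix (Fin n) (Fin n) K ≃ₗ[K] Matrix (Fin n) (Fin n) K where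
  toFun A := P * A * Q
  invFun A := Q * A * P
  map_add' A B := by rw [Matrix.mul_add, Matrix.add_mul]
  map_smul' c A := by simp
  left_inv A := by
    simp only [Matrix.mul_assoc, h1, Matrix.mul_one]
    rw [← Matrix.mul_assoc, h1, Matrix.one_mul]
  right_inv A := by
    simp only [Matrix.mul_assoc, h2, Matrix.mul_one]
    rw [← Matrix.mul_assoc, h2, Matrix.one_mul]

lemma Good.conj (hV : Good V) (P Q : Matrix (Fin n) (Fin n) K) (h1 : Q * P = 1)
    (h2 : P * Q = 1) : Good (V.map (conjEquiv P Q h1 h2).toLinearMap) := by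
  constructor
  · rintro _ ⟨A, hA, rfl⟩
    exact diagz_conj h1 h2 (hV.diagz A hA)
  · rw [← hV.dim]
    exact LinearEquiv.finrank_map_eq _ _

lemma mem_conj {P Q : Matrix (Fin n) (Fin n) K} {h1 : Q * P = 1}
    {h2 : P * Q = 1} {A : Matrix (Fin n) (Fin n) K} :
    A ∈ V.map (conjEquiv P Q h1 h2).toLinearMap ↔ Q * A * P ∈ V := by
  rw [Submodule.mem_map_equiv]
  rfl

lemma Good.exists_rank_one_zero [NeZero n] (hV : Good V) :
    ∃ f : Fin n → K, f 0 = 1 ∧ vecMulVec (Pi.single 0 1) f ∈ V := by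
  obtain ⟨A, hA, hl⟩ := hV.surj (single 0 0 1)
  have hcol : A * single 0 0 1 = single 0 0 1 := by
    ext i j
    by_cases hj : j = 0
    · subst hj
      rw [mul_single_apply_same, mul_one]
      exact hl i 0 (Fin.zero_le i)
    · rw [mul_single_apply_of_ne _ _ _ _ _ hj]
      simp [Ne.symm hj]
  set E : Matrix (Fin n) (Fin n) K := single 0 0 1 with hE
  have hEE : E * E = E := by simp [hE]
  set M := (1 - E) * A with hM
  have hMn : M ^ n = 0 := by
    apply strict_nil
    intro i j hij
    rw [hM, Matrix.sub_mul, Matrix.one_mul, Matrix.sub_apply]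
    by_cases hi : i = 0
    · subst hi
      rw [hE, single_mul_apply_same, one_mul, sub_self]
    · rw [hE, single_mul_apply_of_ne _ _ _ _ _ hi, hl i j hij, hE]
      simp [Ne.symm hi]
  have hAA : A * A - A = 0 := by
    refine diagz_nil (diagz_quad (hV.diagz A hA)) n (strict_nil _ ?_)
    have hup : ∀ i j, j < i → A i j = 0 := by
      intro i j hij
      rw [hl i j hij.le, hE]
      simp only [single_apply]
      rw [if_neg]
      rintro ⟨rfl, rfl⟩
      exact lt_irrefl _ hij
    intro i j hij
    rw [Matrix.sub_apply, mul_apply]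
    rw [Finset.sum_eq_single i]
    · rcases hij.eq_or_lt with rfl | h
      · rw [hl j j le_rfl, hE]
        simp only [single_apply]
        split_ifs <;> simp
      · rw [hup i j h]; simp
    · intro k _ hk
      rcases lt_or_gt_of_ne hk with h | h
      · rw [hup i k h, zero_mul]
      · rw [hup k j (lt_of_le_of_lt hij h), mul_zero]
    · simp
  have hMM : M * M = M := by
    rw [sub_eq_zero] at hAA
    calc M * M = (1 - E) * (A * A) - (1 - E) * (A * E) * A := by rw [hM]; noncomm_ring
      _ = M := by
        rw [hcol, hAA, Matrix.sub_mul 1 E E, Matrix.one_mul, hEE, sub_self, Matrix.zero_mul,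
          sub_zero]
  have hM0 : M = 0 := by
    have : IsIdempotentElem M := hMM
    rw [← this.pow_eq (NeZero.ne n), hMn]
  have hAE : A = E * A := by
    rw [hM, Matrix.sub_mul, Matrix.one_mul, sub_eq_zero] at hM0
    exact hM0
  refine ⟨fun j => A 0 j, ?_, ?_⟩
  · change A 0 0 = 1
    rw [hl 0 0 le_rfl, hE]; simp
  · convert hA
    ext i j
    rw [vecMulVec_apply]
    conv_rhs => rw [hAE]
    by_cases hi : i = 0
    · subst hi
      rw [hE, single_mul_apply_same]
      simp
    · rw [hE, single_mul_apply_of_ne _ _ _ _ _ hi]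
      simp [hi]

lemma vv_single (i j : Fin n) (a b : K) :
    vecMulVec (Pi.single i a) (Pi.single j b) = single i j (a * b) := by
  ext k l
  simp only [vecMulVec_apply, Pi.single_apply, single_apply]
  by_cases h1 : k = i
  · by_cases h2 : l = j
    · simp [h1, h2]
    · simp [h2, Ne.symm h2]
  · simp [h1, Ne.symm h1]

lemma single_mul_diag (i j : Fin n) (c : K) (f : Fin n → K) :
    single i j c * diagonal f = single i j (c * f j) := by
  ext k l
  rw [mul_diagonal]
  simp only [single_apply]
  by_cases h1 : i = k
  · by_cases h2 : j = l
    · simp [h1, h2]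
    · simp [h2]
  · simp [h1]

lemma exists_conj_vec [NeZero n] (x : Fin n → K) (hx : x ≠ 0) :
    ∃ P Q : Matrix (Fin n) (Fin n) K, Q * P = 1 ∧ P * Q = 1 ∧ P *ᵥ (Pi.single 0 1) = x := by
  obtain ⟨g, hg0, hgx⟩ : ∃ g : Fin n → K, g 0 = 1 ∧ g ⬝ᵥ x ≠ 0 := by
    by_cases h : x 0 = 0
    · obtain ⟨i, hi⟩ := Function.ne_iff.1 hx
      have hi0 : i ≠ 0 := by rintro rfl; exact hi h
      refine ⟨Pi.single 0 1 + Pi.single i 1, by simp [Ne.symm hi0], ?_⟩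
      rw [add_dotProduct]
      simpa [h] using hi
    · exact ⟨Pi.single 0 1, by simp, by simpa using h⟩
  have hg1 : g ⬝ᵥ (x - Pi.single 0 1) = g ⬝ᵥ x - 1 := by simp [dotProduct_sub, hg0]
  have hdet : IsUnit (1 + vecMulVec (x - Pi.single 0 1) g).det := by
    have : (1 + vecMulVec (x - Pi.single 0 1) g)
        = 1 + replicateCol Unit (x - Pi.single 0 1) * replicateRow Unit g := by
      rw [vecMulVec_eq Unit]
    rw [this, det_one_add_replicateCol_mul_replicateRow, hg1]
    simpa using hgx
  refine ⟨1 + vecMulVec (x - Pi.single 0 1) g, (1 + vecMulVec (x - Pi.single 0 1) g)⁻¹,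
    nonsing_inv_mul _ hdet, mul_nonsing_inv _ hdet, ?_⟩
  rw [add_mulVec, one_mulVec, vecMulVec_mulVec]
  simp [hg0]

lemma Good.exists_rank_one [NeZero n] (hV : Good V) (x : Fin n → K) (hx : x ≠ 0) :
    ∃ f : Fin n → K, f ⬝ᵥ x = 1 ∧ vecMulVec x f ∈ V := by
  obtain ⟨P, Q, h1, h2, hP⟩ := exists_conj_vec x hx
  obtain ⟨f, hf, hm⟩ := (hV.conj Q P h2 h1).exists_rank_one_zero
  rw [mem_conj, mul_vecMulVec, vecMulVec_mul, hP] at hm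
  refine ⟨f ᵥ* Q, ?_, hm⟩
  rw [← dotProduct_mulVec, ← hP, mulVec_mulVec, h1, one_mulVec]
  simpa using hf

lemma Good.symm (hV : Good V) {x w f g : Fin n → K} (hx : f ⬝ᵥ x = 1) (hw : g ⬝ᵥ w = 1)
    (hf : vecMulVec x f ∈ V) (hg : vecMulVec w g ∈ V) (h : f ⬝ᵥ w = 0) : g ⬝ᵥ x = 0 := by
  have hd := diagz_quad (hV.diagz _ (V.add_mem hf hg))
  have he : (vecMulVec x f + vecMulVec w g) * (vecMulVec x f + vecMulVec w g)
      - (vecMulVec x f + vecMulVec w g) = (g ⬝ᵥ x) • vecMulVec w f := by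
    simp only [Matrix.add_mul, Matrix.mul_add, vecMulVec_mul_vecMulVec, hx, hw, h]
    simp [vecMulVec_smul]
  rw [he] at hd
  have h0 := diagz_nil hd 2 (by
    rw [pow_two]
    simp [vecMulVec_mul_vecMulVec, h])
  rcases smul_eq_zero.1 h0 with h0 | h0
  · exact h0
  · exfalso
    rw [vecMulVec_eq_zero] at h0
    rcases h0 with rfl | rfl
    · simp at hw
    · simp at hx

lemma Good.exists_orth [NeZero n] (hV : Good V) (k : ℕ) (hk : k ≤ n) :
    ∃ x f : Fin k → Fin n → K, (∀ i, vecMulVec (x i) (f i) ∈ V) ∧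
      ∀ i j, f i ⬝ᵥ x j = if i = j then 1 else 0 := by
  induction k with
  | zero => exact ⟨fun i => i.elim0, fun i => i.elim0, fun i => i.elim0, fun i => i.elim0⟩
  | succ k ih =>
    obtain ⟨x, f, hm, ho⟩ := ih (by omega)
    obtain ⟨w, hw0, hw⟩ : ∃ w : Fin n → K, w ≠ 0 ∧ ∀ i, f i ⬝ᵥ w = 0 := by
      have : LinearMap.ker (Matrix.mulVecLin (Matrix.of f)) ≠ ⊥ :=
        LinearMap.ker_ne_bot_of_finrank_lt (by simp; omega)
      obtain ⟨w, hw, hw0⟩ := Submodule.exists_mem_ne_zero_of_ne_bot this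
      refine ⟨w, hw0, fun i => ?_⟩
      exact congrFun (LinearMap.mem_ker.1 hw) i
    obtain ⟨g, hg, hgm⟩ := hV.exists_rank_one w hw0
    have hgx : ∀ i, g ⬝ᵥ x i = 0 := fun i =>
      hV.symm (by simpa using ho i i) hg (hm i) hgm (hw i)
    refine ⟨Fin.snoc x w, Fin.snoc f g, ?_, ?_⟩
    · intro i
      induction i using Fin.lastCases with
      | last => simpa using hgm
      | cast i => simpa using hm i
    · intro i j
      induction i using Fin.lastCases with
      | last =>
        induction j using Fin.lastCases with
        | last => simpa using hg
        | cast j => simp [hgx, (Fin.castSucc_lt_last j).ne']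
      | cast i =>
        induction j using Fin.lastCases with
        | last => simp [hw, (Fin.castSucc_lt_last i).ne]
        | cast j => simpa using ho i j

lemma Good.exists_conj_diag [NeZero n] (hV : Good V) :
    ∃ (P Q : Matrix (Fin n) (Fin n) K), Q * P = 1 ∧ P * Q = 1 ∧
      ∀ i c, P * single i i c * Q ∈ V := by
  obtain ⟨x, f, hm, ho⟩ := hV.exists_orth n le_rfl
  have h1 : (of f) * (of x)ᵀ = 1 := by
    ext i j
    rw [one_apply, ← ho i j]
    rfl
  refine ⟨(of x)ᵀ, of f, h1, mul_eq_one_comm.1 h1, fun i c => ?_⟩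
  have : single i i c = c • vecMulVec (Pi.single i 1) (Pi.single i 1) := by
    rw [vv_single, smul_single]; simp
  rw [this, Matrix.mul_smul, Matrix.smul_mul]
  apply V.smul_mem
  rw [mul_vecMulVec, vecMulVec_mul]
  convert hm i using 2
  · ext a; simp
  · ext a; simp

/-- With all diagonal units in `V`, the space is `S_n` times a diagonal. -/
lemma Good.normal_form [NeZero n] (hV : Good V) (hE : ∀ i c, single i i c ∈ V) :
    ∃ f : Fin n → K, (∀ i, f i ≠ 0) ∧
      (∀ i j, i ≠ j → single i j (f j) + single j i (f i) ∈ V) := by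
  have hone : (1 : Fin n → K) ≠ 0 := fun h => by simpa using congrFun h 0
  have hEv : ∀ i, vecMulVec (Pi.single i 1) (Pi.single i (1 : K)) ∈ V := fun i => by
    rw [vv_single]
    exact hE i _
  obtain ⟨f, hf, hfm⟩ := hV.exists_rank_one 1 hone
  have hf0 : ∀ i, f i ≠ 0 := by
    intro i hi
    have := hV.symm (x := 1) (w := Pi.single i 1) (f := f) (g := Pi.single i 1) hf (by simp) hfm
      (hEv i) (by simpa using hi)
    simp at this
  refine ⟨f, hf0, fun i j hij => ?_⟩
  have hw0 : (Pi.single i (f j) - Pi.single j (f i) : Fin n → K) ≠ 0 := by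
    intro h
    have := congrFun h i
    simp [hij, hf0] at this
  obtain ⟨g, hg, hgm⟩ := hV.exists_rank_one _ hw0
  have hg1 : g ⬝ᵥ 1 = 0 := by
    refine hV.symm hf hg hfm hgm ?_
    simp [dotProduct_sub, mul_comm]
  have hgk : ∀ k, k ≠ i → k ≠ j → g k = 0 := by
    intro k hki hkj
    have := hV.symm (x := Pi.single k 1) (f := Pi.single k 1) (by simp) hg (hEv k) hgm
      (by simp [hki, hkj])
    simpa using this
  have hgi : g i = - g j := by
    rw [dotProduct, Finset.sum_eq_add i j hij] at hg1
    · simpa using eq_neg_of_add_eq_zero_left hg1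
    · intro c _ hc
      simp [hgk c hc.1 hc.2]
    · simp
    · simp
  have hgj : g j ≠ 0 := by
    intro h
    have : g = 0 := by
      ext k
      by_cases h1 : k = i
      · rw [h1, hgi, h]; simp
      by_cases h2 : k = j
      · rw [h2, h]; simp
      exact hgk k h1 h2
    simp [this] at hg
  have : single i j (f j) + single j i (f i) = (g j)⁻¹ •
      vecMulVec (Pi.single i (f j) - Pi.single j (f i) : Fin n → K) g
      + single i i (f j) + single j j (f i) := by
    have hij' := hij.symm
    have hgg : g = Pi.single j (g j) - Pi.single i (g j) := by
      ext k
      by_cases h1 : k = i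
      · subst h1; simp [hij, hgi]
      by_cases h2 : k = j
      · subst h2; simp [h1]
      simp [h1, h2, hgk]
    have e : (g j)⁻¹ • vecMulVec (Pi.single i (f j) - Pi.single j (f i) : Fin n → K) g
        = single i j (f j) - single i i (f j) - (single j j (f i) - single j i (f i)) := by
      have hc : ∀ c : K, (g j)⁻¹ * (c * g j) = c := fun c => by field_simp
      conv_lhs => rw [hgg]
      simp only [sub_vecMulVec, vecMulVec_sub, vv_single, smul_sub, smul_single, smul_eq_mul]
      simp [hij, hc]
      abel
    rw [e]
    abel
  rw [this]
  exact V.add_mem (V.add_mem (V.smul_mem _ hgm) (hE _ _)) (hE _ _)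

lemma Good.normal_form_mem (hV : Good V) (hE : ∀ i c, single i i c ∈ V)
    (f : Fin n → K) (hf : ∀ i, f i ≠ 0)
    (hF : ∀ i j, i ≠ j → single i j (f j) + single j i (f i) ∈ V) (A : Matrix (Fin n) (Fin n) K) :
    A ∈ V ↔ ∃ S : Matrix (Fin n) (Fin n) K, S.IsSymm ∧ A = S * diagonal f := by
  have hdiag : ∀ d : Fin n → K, diagonal d ∈ V := by
    intro d
    rw [← sum_single_eq_diagonal]
    exact V.sum_mem fun i _ => hE i _
  have hL : ∀ L : Matrix (Fin n) (Fin n) K, (L + Lᵀ) * diagonal f ∈ V := by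
    intro L
    induction L using Matrix.induction_on' with
    | h_zero => simp
    | h_add p q hp hq =>
      have : (p + q + (p + q)ᵀ) * diagonal f
        = (p + pᵀ) * diagonal f + (q + qᵀ) * diagonal f := by
        rw [transpose_add]; noncomm_ring
      rw [this]
      exact V.add_mem hp hq
    | h_std_basis i j c =>
      have : (single i j c + (single i j c)ᵀ) * diagonal f
          = c • (single i j (f j) + single j i (f i)) := by
        rw [transpose_single, Matrix.add_mul, smul_add]
        congr 1 <;> rw [single_mul_diag] <;> simp
      rw [this]
      apply V.smul_mem
      by_cases hij : i = j
      · subst hij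
        exact V.add_mem (hE _ _) (hE _ _)
      · exact hF i j hij
  have hS : ∀ S : Matrix (Fin n) (Fin n) K, S.IsSymm → S * diagonal f ∈ V := by
    intro S hS
    have : S = (of fun i j => if j < i then S i j else 0)
        + (of fun i j => if j < i then S i j else 0)ᵀ + diagonal (fun i => S i i) := by
      ext i j
      rcases lt_trichotomy i j with h | rfl | h
      · simp [h, h.not_gt, h.ne, hS.apply]
      · simp
      · simp [h, h.not_gt, h.ne']
    rw [this, Matrix.add_mul]
    refine V.add_mem (hL _) ?_
    rw [diagonal_mul_diagonal]
    exact hdiag _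
  constructor
  · intro hA
    have hsym : (of fun i j => if j ≤ i then A i j / f j else A j i / f i).IsSymm := by
      ext i j
      rcases lt_trichotomy i j with h | rfl | h
      · simp [h.le, h.not_ge]
      · simp
      · simp [h.le, h.not_ge]
    refine ⟨_, hsym, hV.inj hA (hS _ hsym) fun i j hij => ?_⟩
    simp [mul_diagonal, hij, hf]
  · rintro ⟨S, h, rfl⟩
    exact hS S h

lemma eig_sq {i j : Fin n} (hij : i ≠ j) {a b : K} (ha : a ≠ 0)
    (h : IsDiagonalizable (single i j a + single j i b)) : ∃ c, a * b = c ^ 2 := by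
  obtain ⟨c, v, hc, hv, he⟩ := diagz_eig h (by
    intro h0
    have := congrFun (congrFun h0 i) j
    simp [hij, ha] at this)
  have hk : ∀ k, k ≠ i → k ≠ j → v k = 0 := by
    intro k hi hj
    have := congrFun he k
    rw [add_mulVec] at this
    simpa [single_mulVec, hi, hj, hc] using this
  have h1 := congrFun he i
  have h2 := congrFun he j
  rw [add_mulVec] at h1 h2
  simp [single_mulVec, hij, hij.symm] at h1 h2
  refine ⟨c, ?_⟩
  have hvj : v j ≠ 0 := by
    intro h0
    apply hv
    ext k
    by_cases hi : k = i
    · subst hi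
      simpa [h0, hc] using h1
    by_cases hj : k = j
    · rw [hj, h0]; rfl
    exact hk k hi hj
  have : (a * b) * v j = c ^ 2 * v j := by
    rw [pow_two, mul_assoc c, ← h2]
    linear_combination b * h1
  exact mul_right_cancel₀ hvj this

end main

section final
variable {K : Type*} [Field K] {n : ℕ}

lemma Good.conj_symm [NeZero n] {V : Submodule K (Matrix (Fin n) (Fin n) K)} (hV : Good V) :
    ∃ P Q : Matrix (Fin n) (Fin n) K, Q * P = 1 ∧ P * Q = 1 ∧
      ∀ A, A ∈ V ↔ ∃ S : Matrix (Fin n) (Fin n) K, S.IsSymm ∧ P * S * Q = A := by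
  obtain ⟨P, Q, h1, h2, hE⟩ := hV.exists_conj_diag
  have hW := hV.conj Q P h2 h1
  have hE' : ∀ i c, single i i c ∈ V.map (conjEquiv Q P h2 h1).toLinearMap := fun i c => by
    rw [mem_conj]; exact hE i c
  obtain ⟨f, hf, hF⟩ := hW.normal_form hE'
  have hmem := hW.normal_form_mem hE' f hf hF
  have hc : ∀ i, ∃ c, f 0 * f i = c ^ 2 := by
    intro i
    by_cases hi : i = 0
    · exact ⟨f 0, by rw [hi, pow_two]⟩
    · have := hW.diagz _ (hF i 0 hi)
      exact eig_sq hi (hf 0) this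
  choose c hc using hc
  have hc0 : ∀ i, c i ≠ 0 := by
    intro i h
    have := hc i
    rw [h] at this
    simp [hf] at this
  have hDD : diagonal f = (f 0)⁻¹ • (diagonal c * diagonal c) := by
    rw [diagonal_mul_diagonal, ← diagonal_smul]
    congr 1
    ext i
    have := hc i
    have h0 := hf 0
    simp only [Pi.smul_apply, smul_eq_mul]
    field_simp
    rw [← this, mul_comm]
  set D := diagonal c with hD
  set D' := diagonal (fun i => (c i)⁻¹) with hD'
  have e1 : D * D' = 1 := by
    rw [hD, hD', diagonal_mul_diagonal]; simp [hc0]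
  have e2 : D' * D = 1 := mul_eq_one_comm.1 e1
  have tD : Dᵀ = D := diagonal_transpose _
  have tD' : D'ᵀ = D' := diagonal_transpose _
  have e2' : ∀ X, D' * (D * X) = X := fun X => by rw [← Matrix.mul_assoc, e2, Matrix.one_mul]
  have e1' : ∀ X, D * (D' * X) = X := fun X => by rw [← Matrix.mul_assoc, e1, Matrix.one_mul]
  have h1' : ∀ X, Q * (P * X) = X := fun X => by rw [← Matrix.mul_assoc, h1, Matrix.one_mul]
  have h2' : ∀ X, P * (Q * X) = X := fun X => by rw [← Matrix.mul_assoc, h2, Matrix.one_mul]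
  refine ⟨P * D', D * Q, ?_, ?_, fun A => ?_⟩
  · simp only [Matrix.mul_assoc, h1', e1]
  · simp only [Matrix.mul_assoc, e2', h2]
  have hA : A ∈ V ↔ Q * A * P ∈ V.map (conjEquiv Q P h2 h1).toLinearMap := by
    rw [mem_conj]
    simp only [Matrix.mul_assoc, h2', h2, Matrix.mul_one]
  rw [hA, hmem]
  constructor
  · rintro ⟨S, hS, h⟩
    refine ⟨(f 0)⁻¹ • (D * S * D), ?_, ?_⟩
    · rw [IsSymm, transpose_smul, transpose_mul, transpose_mul, hS, tD, Matrix.mul_assoc]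
    · have : A = P * (Q * A * P) * Q := by
        simp only [Matrix.mul_assoc, h2', h2, Matrix.mul_one]
      rw [this, h, hDD]
      simp only [Matrix.mul_assoc, Matrix.mul_smul, Matrix.smul_mul, e2']
  · rintro ⟨S, hS, rfl⟩
    refine ⟨f 0 • (D' * S * D'), ?_, ?_⟩
    · rw [IsSymm, transpose_smul, transpose_mul, transpose_mul, hS, tD', Matrix.mul_assoc]
    · rw [hDD]
      simp only [Matrix.mul_assoc, Matrix.mul_smul, Matrix.smul_mul, e2', h1', h1, Matrix.mul_one,
        smul_smul]
      rw [inv_mul_cancel₀ (hf 0), one_smul]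

lemma sum_sq_eig (i j : Fin n) (hij : i ≠ j)
    (h : ∀ A : Matrix (Fin n) (Fin n) K, A.IsSymm → IsDiagonalizable A) (a b : K)
    (hab : a ≠ 0) : ∃ c, c ≠ 0 ∧ a ^ 2 + b ^ 2 = c ^ 2 := by
  set M : Matrix (Fin n) (Fin n) K :=
    single i i a + single j j (-a) + single i j b + single j i b with hM
  have hs : M.IsSymm := by
    rw [IsSymm, hM]
    simp only [transpose_add, transpose_single]
    abel
  obtain ⟨c, v, hc, hv, he⟩ := diagz_eig (h M hs) (by
    intro h0
    have := congrFun (congrFun h0 i) i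
    simp [hM, hij.symm, hab] at this)
  rw [hM] at he
  simp only [add_mulVec] at he
  have hk : ∀ k, k ≠ i → k ≠ j → v k = 0 := by
    intro k hi hj
    have := congrFun he k
    simpa [single_mulVec, hi, hj, hc] using this
  have h1 := congrFun he i
  have h2 := congrFun he j
  simp [single_mulVec, hij, hij.symm] at h1 h2
  refine ⟨c, hc, ?_⟩
  by_contra hne
  have hne' : a ^ 2 + b ^ 2 - c ^ 2 ≠ 0 := sub_ne_zero.2 hne
  have hi0 : (a ^ 2 + b ^ 2 - c ^ 2) * v i = 0 := by linear_combination (a + c) * h1 + b * h2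
  have hj0 : (a ^ 2 + b ^ 2 - c ^ 2) * v j = 0 := by linear_combination b * h1 + (c - a) * h2
  apply hv
  ext k
  by_cases hi : k = i
  · rw [hi]; simpa [hne'] using hi0
  by_cases hj : k = j
  · rw [hj]; simpa [hne'] using hj0
  exact hk k hi hj

end final

theorem stmt12 {K : Type*} [Field K] {n : ℕ} (hn : 2 ≤ n)
    (V : Submodule K (Matrix (Fin n) (Fin n) K))
    (hV : ∀ A ∈ V, IsDiagonalizable A)
    (hdim : Module.finrank K V = n * (n + 1) / 2) :
    (∃ P : Matrix (Fin n) (Fin n) K, IsUnit P ∧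
        (V : Set (Matrix (Fin n) (Fin n) K)) = (fun S => P * S * P⁻¹) '' {S | S.IsSymm}) ∧
      FormallyReal K ∧ Pythagorean K ∧
      (∀ A : Matrix (Fin n) (Fin n) K, A.IsSymm → IsDiagonalizable A) := by
  have hG : Good V := ⟨hV, hdim⟩
  have : NeZero n := ⟨by omega⟩
  obtain ⟨P, Q, h1, h2, hmem⟩ := hG.conj_symm
  have hQ : P⁻¹ = Q := Matrix.inv_eq_left_inv h1
  have hsym : ∀ A : Matrix (Fin n) (Fin n) K, A.IsSymm → IsDiagonalizable A := by
    intro A hA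
    have hd := diagz_conj h2 h1 (hV _ ((hmem (P * A * Q)).2 ⟨A, hA, rfl⟩))
    have : Q * (P * A * Q) * P = A := by
      simp only [Matrix.mul_assoc, h1, Matrix.mul_one]
      rw [← Matrix.mul_assoc, h1, Matrix.one_mul]
    rwa [this] at hd
  have hsq := sum_sq_eig (K := K) (⟨0, by omega⟩ : Fin n) ⟨1, by omega⟩ (by simp) hsym
  have hpy : Pythagorean K := by
    intro a b
    by_cases ha : a = 0
    · exact ⟨b, by simp [ha]⟩
    · obtain ⟨c, -, hc⟩ := hsq a b ha
      exact ⟨c, hc⟩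
  refine ⟨⟨P, ⟨⟨P, Q, h2, h1⟩, rfl⟩, ?_⟩, ?_, hpy, hsym⟩
  · ext A
    rw [hQ]
    exact hmem A
  · intro h
    have hall : ∀ s : K, IsSumSq s → ∃ c, s = c ^ 2 := by
      intro s hs
      induction hs with
      | zero => exact ⟨0, by simp⟩
      | sq_add a _ ih =>
        obtain ⟨c, rfl⟩ := ih
        obtain ⟨d, hd⟩ := hpy a c
        exact ⟨d, by rw [← hd]; ring⟩
    obtain ⟨c, hc⟩ := hall _ h
    obtain ⟨d, hd0, hd⟩ := hsq 1 c one_ne_zero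
    rw [← hc] at hd
    apply hd0
    simpa using hd.symm
end
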